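/- Let q be an odd prime. Then every irreducible complex character χ of PGL_2(q) of degree q−1 is not unisingular; more precisely, for any representation Φ affording χ there exists an element g of PGL_2(q) of order q such that Φ(g) does not have 1 as an eigenvalue. -/

import Mathlib

open Module FDRep Matrix CategoryTheory

/-- A finite-dimensional complex representation of a group is *unisingular* if every group
element acts with `1` as an eigenvalue. -/
def FDRep.IsUnisingular {G : Type} [Monoid G] (V : FDRep ℂ G) : Prop :=
  ∀ g : G, Module.End.HasEigenvalue (V.ρ g) 1


/-- The projective general linear group: the quotient of `GL n R` by its center. -/
abbrev Matrix.ProjectiveGeneralLinearGroup (n : Type*) [DecidableEq n] [Fintype n]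
    (R : Type*) [CommRing R] : Type _ :=
  GL n R ⧸ Subgroup.center (GL n R)

/-- `PGL₂(F)`, the projective general linear group of degree 2 over `F`. -/
abbrev PGL2 (F : Type) [Field F] : Type _ :=
  Matrix.ProjectiveGeneralLinearGroup (Fin 2) F

/-- Let `T` have finite order dividing a prime `n`, and suppose that `T` is conjugate to `T ^ k` for
`0 < k < n`. If `T ≠ 1` has the eigenvalue `1`, then all `n`-th roots of unity are eigenvalues. -/
theorem Module.End.le_finrank_of_hasEigenvalue_one {W : Type*} [AddCommGroup W] [Module ℂ W]
    [FiniteDimensional ℂ W] {n : ℕ} (hn : n.Prime) {T : Module.End ℂ W} (hT : T ^ n = 1)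
    (hT1 : T ≠ 1) (h1 : T.HasEigenvalue 1)
    (hconj : ∀ k, 0 < k → k < n → ∃ P : Module.End ℂ W, IsUnit P ∧ P * T = T ^ k * P) :
    n ≤ Module.finrank ℂ W := by
  obtain ⟨ζ, hζ1, hζ⟩ : ∃ ζ : ℂ, ζ ≠ 1 ∧ T.HasEigenvalue ζ := by
    by_contra! hno
    have hprod : (Polynomial.X ^ n - 1 : Polynomial ℂ) =
        ∏ ζ ∈ Polynomial.nthRootsFinset n (1 : ℂ), (Polynomial.X - Polynomial.C ζ) :=
      Polynomial.X_pow_sub_one_eq_prod hn.pos (Complex.isPrimitiveRoot_exp n hn.ne_zero)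
    have hmem : (1 : ℂ) ∈ Polynomial.nthRootsFinset n (1 : ℂ) := by
      rw [Polynomial.mem_nthRootsFinset hn.pos, one_pow]
    rw [← Finset.prod_erase_mul _ _ hmem] at hprod
    have hunit : IsUnit (Polynomial.aeval T (∏ ζ ∈ (Polynomial.nthRootsFinset n (1 : ℂ)).erase 1,
        (Polynomial.X - Polynomial.C ζ))) := by
      refine Finset.prod_induction _ (fun p => IsUnit (Polynomial.aeval T p))
        (fun a b ha hb => by rw [map_mul]; exact ha.mul hb) (by simp) fun ζ hζ => ?_
      have := hno ζ (Finset.ne_of_mem_erase hζ)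
      rw [Module.End.hasEigenvalue_iff_mem_spectrum, spectrum.mem_iff, not_not,
        IsUnit.sub_iff] at this
      simpa using this
    have h0 := congrArg (Polynomial.aeval T) hprod
    rw [map_mul] at h0
    simp only [map_sub, map_pow, Polynomial.aeval_X, hT, map_one, sub_self] at h0
    exact hT1 (sub_eq_zero.mp (hunit.mul_right_eq_zero.mp h0.symm))
  obtain ⟨v, hv⟩ := hζ.exists_hasEigenvector
  have hζn : ζ ^ n = 1 := by
    have h := hv.pow_apply n
    rw [hT, Module.End.one_apply] at h
    exact (smul_left_injective ℂ hv.2 (by simpa using h)).symm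
  have hprim : IsPrimitiveRoot ζ n := by
    rw [← orderOf_eq_prime (hp := ⟨hn⟩) hζn hζ1]
    exact IsPrimitiveRoot.orderOf ζ
  have hev : ∀ k : Fin n, T.HasEigenvalue (ζ ^ (k : ℕ)) := by
    intro k
    rcases Nat.eq_zero_or_pos (k : ℕ) with hk | hk
    · rw [hk, pow_zero]; exact h1
    · obtain ⟨P, ⟨P, rfl⟩, hP⟩ := hconj k hk k.2
      have hPv : (P : Module.End ℂ W) ((↑P⁻¹ : Module.End ℂ W) v) = v := by
        rw [← Module.End.mul_apply, P.mul_inv, Module.End.one_apply]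
      have hinj : Function.Injective (P : Module.End ℂ W) :=
        ((Module.End.isUnit_iff _).mp P.isUnit).1
      refine Module.End.hasEigenvalue_of_hasEigenvector (x := (↑P⁻¹ : Module.End ℂ W) v)
        ⟨Module.End.mem_eigenspace_iff.mpr (hinj ?_), fun h => hv.2 (by rw [← hPv, h, map_zero])⟩
      rw [← Module.End.mul_apply, hP, Module.End.mul_apply, map_smul, hPv, hv.pow_apply]
  choose w hw using fun k => (hev k).exists_hasEigenvector
  have hli := T.eigenvectors_linearIndependent' (fun k : Fin n => ζ ^ (k : ℕ))
    (fun a b hab => Fin.ext (hprim.pow_inj a.2 b.2 hab)) w hw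
  simpa using hli.fintype_card_le_finrank

/-- A simple representation whose operators commute with each other is one-dimensional. -/
theorem FDRep.finrank_eq_one_of_commute {k : Type} [Field k] [IsAlgClosed k] {G : Type} [Monoid G]
    (V : FDRep k G) [Simple V] (hcomm : ∀ g h : G, Commute (V.ρ g) (V.ρ h)) :
    Module.finrank k V = 1 := by
  have hscalar : ∀ f : V →ₗ[k] V, (∀ g, Commute f (V.ρ g)) → ∃ c : k, c • LinearMap.id = f := by
    intro f hf
    let F : V ⟶ V := ⟨InducedCategory.homMk (ModuleCat.ofHom f), fun g => by
      ext x
      exact LinearMap.congr_fun (hf g).eq x⟩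
    obtain ⟨c, hc⟩ := endomorphism_simple_eq_smul_id k F
    exact ⟨c, congrArg (fun φ : V ⟶ V => φ.hom.hom.hom) hc⟩
  have hall : ∀ f : V →ₗ[k] V, ∃ c : k, c • LinearMap.id = f := fun f => hscalar f fun g => by
    obtain ⟨c, hc⟩ := hscalar (V.ρ g) (hcomm g)
    rw [← hc]
    exact (Commute.one_right f).smul_right c
  have hnt : Nontrivial V := by
    by_contra hV
    rw [not_nontrivial_iff_subsingleton] at hV
    apply id_nonzero V
    ext x
    exact Subsingleton.elim _ _
  have hend : Module.finrank k (V →ₗ[k] V) = 1 :=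
    (finrank_eq_one_iff_of_nonzero' LinearMap.id
      (one_ne_zero (α := Module.End k V))).mpr hall
  rw [Module.finrank_linearMap] at hend
  exact Nat.eq_one_of_mul_eq_one_left hend

namespace Matrix.GeneralLinearGroup

variable {F : Type*} [Field F]

/-- The invertible diagonal matrix with diagonal entries `a` and `b`. -/
def diagTwo (a b : Fˣ) : GL (Fin 2) F :=
  mkOfDetNeZero !![(a : F), 0; 0, (b : F)] (by simp)

@[simp]
theorem coe_diagTwo (a b : Fˣ) : (diagTwo a b : Matrix (Fin 2) (Fin 2) F) = !![(a : F), 0; 0, ↑b] :=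
  rfl

theorem diagTwo_mul (a b c d : Fˣ) : diagTwo a b * diagTwo c d = diagTwo (a * c) (b * d) := by
  apply Units.ext
  simp

theorem diagTwo_mul_upperRightHom_one (c : Fˣ) :
    diagTwo c 1 * upperRightHom (1 : F) = upperRightHom (c : F) * diagTwo c 1 := by
  apply Units.ext
  simp

/-- A homomorphism from `GL₂(F)` that kills a nontrivial transvection has commutative image. -/
theorem commute_map_of_map_upperRightHom_one {M : Type*} [Monoid M] (φ : GL (Fin 2) F →* M)
    (h : φ (upperRightHom 1) = 1) (x y : GL (Fin 2) F) : Commute (φ x) (φ y) := by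
  have hconj : ∀ g t s : GL (Fin 2) F, φ s = 1 → g * s = t * g → φ t = 1 := by
    intro g t s hs hst
    have := congrArg φ hst
    rw [map_mul, map_mul, hs, mul_one] at this
    exact ((Group.isUnit g).map φ).mul_eq_right.mp this.symm
  have hupper : ∀ c : F, φ (upperRightHom c) = 1 := by
    intro c
    rcases eq_or_ne c 0 with rfl | hc
    · rw [AddChar.map_zero_eq_one, map_one]
    · exact hconj _ _ _ h (diagTwo_mul_upperRightHom_one (Units.mk0 c hc))
  let w : GL (Fin 2) F := mkOfDetNeZero !![0, 1; 1, 0] (by simp)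
  have hdiag : ∀ g : GL (Fin 2) F, ∃ a b, φ g = φ (diagTwo a b) := by
    intro g
    suffices ∀ g' : GL (Fin 2) F, g'.val = g.val → ∃ a b, φ g' = φ (diagTwo a b) from this g rfl
    refine diagonal_transvection_induction_of_det_ne_zero
      (fun A => ∀ g' : GL (Fin 2) F, g'.val = A → ∃ a b, φ g' = φ (diagTwo a b)) g.val
      g.det_ne_zero ?_ ?_ ?_
    · intro D hD g' hg'
      simp only [det_diagonal, Fin.prod_univ_two] at hD
      refine ⟨Units.mk0 _ (left_ne_zero_of_mul hD), Units.mk0 _ (right_ne_zero_of_mul hD), ?_⟩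
      congr 1
      apply Units.ext
      rw [hg']
      ext i j
      fin_cases i <;> fin_cases j <;> simp
    · rintro ⟨i, j, hij, c⟩ g' hg'
      refine ⟨1, 1, ?_⟩
      have h1 : (diagTwo 1 1 : GL (Fin 2) F) = 1 := by
        apply Units.ext
        simp [one_fin_two]
      rw [h1, map_one]
      rw [TransvectionStruct.toMatrix_mk] at hg'
      by_cases hi : i = 0
      · obtain rfl : j = 1 := by omega
        subst hi
        rw [← hupper c]
        congr 1
        apply Units.ext
        rw [hg']
        ext i j
        fin_cases i <;> fin_cases j <;> simp [transvection, single]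
      · obtain rfl : i = 1 := by omega
        obtain rfl : j = 0 := by omega
        refine hconj w g' _ (hupper c) (Units.ext ?_)
        rw [Units.val_mul, Units.val_mul, hg']
        ext i j
        fin_cases i <;> fin_cases j <;> simp [w, mkOfDetNeZero, transvection, single, mul_apply]
    · intro A B hA hB ihA ihB g' hg'
      obtain ⟨a, b, hab⟩ := ihA (mkOfDetNeZero A hA) rfl
      obtain ⟨c, d, hcd⟩ := ihB (mkOfDetNeZero B hB) rfl
      have hmul : g' = mkOfDetNeZero A hA * mkOfDetNeZero B hB := Units.ext hg'
      exact ⟨a * c, b * d, by rw [hmul, map_mul, hab, hcd, ← map_mul, diagTwo_mul]⟩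
  obtain ⟨a, b, hx⟩ := hdiag x
  obtain ⟨c, d, hy⟩ := hdiag y
  rw [hx, hy, commute_iff_eq, ← map_mul, ← map_mul, diagTwo_mul, diagTwo_mul, mul_comm a,
    mul_comm b]

theorem upperRightHom_one_notMem_center :
    upperRightHom (1 : F) ∉ Subgroup.center (GL (Fin 2) F) := by
  rw [center_eq_range_scalar]
  rintro ⟨r, hr⟩
  have h01 : (Matrix.scalar (Fin 2) (r : F)) 0 1 = !![1, (1 : F); 0, 1] 0 1 :=
    congrArg (fun g : GL (Fin 2) F => g.val 0 1) hr
  simp at h01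

end Matrix.GeneralLinearGroup

/-- Let `F` be a finite field with `q` elements, `q` an odd prime. Every
irreducible complex character of `PGL₂(q)` of degree `q - 1` is not unisingular; more
precisely, there is an element `g` of order `q` acting without the eigenvalue `1`. -/
theorem PGL2_not_unisingular_of_deg_q_sub_one (q : ℕ) (hq : q.Prime) (hodd : Odd q)
    (F : Type) [Field F] [Fintype F] (hF : Fintype.card F = q)
    (V : FDRep ℂ (PGL2 F)) (hV : Simple V)
    (hdeg : Module.finrank ℂ V = q - 1) :
    ¬ V.IsUnisingular ∧
      ∃ g : PGL2 F, orderOf g = q ∧ ¬ Module.End.HasEigenvalue (V.ρ g) 1 := by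
  have := Fact.mk hq
  have : CharP F q := charP_of_card_eq_prime hF
  let φ : GL (Fin 2) F →* Module.End ℂ V :=
    V.ρ.comp (QuotientGroup.mk' (Subgroup.center (GL (Fin 2) F)))
  let u : GL (Fin 2) F := GeneralLinearGroup.upperRightHom 1
  have hpow : ∀ k : ℕ, u ^ k = GeneralLinearGroup.upperRightHom (k : F) := fun k => by
    rw [← AddChar.map_nsmul_eq_pow, nsmul_one]
  have huq : u ^ q = 1 := by
    rw [hpow, CharP.cast_eq_zero, AddChar.map_zero_eq_one]
  have hu : ¬ Module.End.HasEigenvalue (V.ρ (u : PGL2 F)) 1 := by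
    intro h1
    have hne : φ u ≠ 1 := fun h => by
      have h2 := V.finrank_eq_one_of_commute fun g h' => by
        obtain ⟨g, rfl⟩ := QuotientGroup.mk_surjective g
        obtain ⟨h', rfl⟩ := QuotientGroup.mk_surjective h'
        exact GeneralLinearGroup.commute_map_of_map_upperRightHom_one φ h g h'
      obtain ⟨m, rfl⟩ := hodd
      omega
    have hle := Module.End.le_finrank_of_hasEigenvalue_one hq (T := φ u)
      (by rw [← map_pow, huq, map_one]) hne h1 fun k hk hkq => by
        have hk0 : (k : F) ≠ 0 := fun h =>
          Nat.not_dvd_of_pos_of_lt hk hkq ((CharP.cast_eq_zero_iff F q k).mp h)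
        refine ⟨φ (GeneralLinearGroup.diagTwo (Units.mk0 _ hk0) 1), (Group.isUnit _).map φ, ?_⟩
        rw [← map_pow, ← map_mul, ← map_mul, hpow]
        exact congrArg φ (GeneralLinearGroup.diagTwo_mul_upperRightHom_one (Units.mk0 _ hk0))
    have := hq.pos
    omega
  refine ⟨fun h => hu (h u), u, orderOf_eq_prime ?_ fun h => ?_, hu⟩
  · rw [← QuotientGroup.mk_pow, huq, QuotientGroup.mk_one]
  · exact GeneralLinearGroup.upperRightHom_one_notMem_center ((QuotientGroup.eq_one_iff u).mp h)
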